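/- Assume (A2). Let μ_x, μ_x' ∈ P₂(ℝ^{d_x}), and let μ, μ' ∈ P₂(ℝ^{d_z}) be minimizers with finite value of ν ↦ 𝓕₁(μ_x, ν) and of ν ↦ 𝓕₁(μ_x', ν) over P₂(ℝ^{d_z}), respectively. Then KL(μ, μ') + KL(μ', μ) ≤ (R²/(2σ₁))·KL(μ_x, μ_x'), the inequality holding in [0, +∞]. -/

import Mathlib

open MeasureTheory ProbabilityTheory Real Filter
open scoped ENNReal Classical

noncomputable section

/-- `Euc d` is Euclidean space `ℝ^d`. -/
abbrev Euc (d : ℕ) : Type := EuclideanSpace ℝ (Fin d)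

/-- `P₂(ℝ^d)`: Borel probability measures with finite second moment. -/
def IsP2 {d : ℕ} (μ : Measure (Euc d)) : Prop :=
  IsProbabilityMeasure μ ∧ Integrable (fun x => ‖x‖ ^ 2) μ

/-- Negative entropy of a probability measure, valued in `ℝ ∪ {+∞}` (as `EReal`):
the integral `∫ log(dμ/dLeb) dμ` if `μ` is absolutely continuous w.r.t. Lebesgue measure
and that integral exists in `ℝ`, and `+∞` otherwise. -/
def Ent {d : ℕ} (μ : Measure (Euc d)) : EReal :=
  if μ ≪ (volume : Measure (Euc d)) ∧
      Integrable (fun x => Real.log (μ.rnDeriv volume x).toReal) μ then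
    ((∫ x, Real.log (μ.rnDeriv volume x).toReal ∂μ : ℝ) : EReal)
  else ⊤

/-- Kullback–Leibler divergence `KL(ν, μ)`, valued in `ℝ ∪ {+∞}` (as `EReal`). -/
def KL {α : Type*} [MeasurableSpace α] (ν μ : Measure α) : EReal :=
  if ν ≪ μ ∧ Integrable (fun x => Real.log (ν.rnDeriv μ x).toReal) ν then
    ((∫ x, Real.log (ν.rnDeriv μ x).toReal ∂ν : ℝ) : EReal)
  else ⊤

section Setting

variable {da dw dx dz : ℕ}

/-- Stage-I unregularized objective `U₁`. -/
def U1 (ρ : Measure (Euc da × Euc dw × ℝ)) (ΨA : Euc da → Euc dx → ℝ)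
    (ΨW : Euc dw → Euc dz → ℝ) (μx : Measure (Euc dx)) (μz : Measure (Euc dz)) : ℝ :=
  (1 / 2) * ∫ p, ((∫ z, ΨW p.2.1 z ∂μz) - (∫ x, ΨA p.1 x ∂μx)) ^ 2 ∂ρ

/-- Stage-II unregularized objective `U₂`. -/
def U2 (ρ : Measure (Euc da × Euc dw × ℝ)) (ΨW : Euc dw → Euc dz → ℝ)
    (μz : Measure (Euc dz)) : ℝ :=
  (1 / 2) * ∫ p, ((∫ z, ΨW p.2.1 z ∂μz) - p.2.2) ^ 2 ∂ρ

/-- `F₁ = U₁ + (ζ₁/2)·second moment of μ_z`. -/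
def F1 (ρ : Measure (Euc da × Euc dw × ℝ)) (ΨA : Euc da → Euc dx → ℝ)
    (ΨW : Euc dw → Euc dz → ℝ) (ζ1 : ℝ) (μx : Measure (Euc dx)) (μz : Measure (Euc dz)) : ℝ :=
  U1 ρ ΨA ΨW μx μz + (ζ1 / 2) * ∫ z, ‖z‖ ^ 2 ∂μz

/-- `F₂ = U₂ + (ζ₂/2)·second moment of μ_x`. -/
def F2 (ρ : Measure (Euc da × Euc dw × ℝ)) (ΨW : Euc dw → Euc dz → ℝ) (ζ2 : ℝ)
    (μx : Measure (Euc dx)) (μz : Measure (Euc dz)) : ℝ :=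
  U2 ρ ΨW μz + (ζ2 / 2) * ∫ x, ‖x‖ ^ 2 ∂μx

/-- `𝓕₁ = F₁ + σ₁·Ent(μ_z)`, valued in `ℝ ∪ {+∞}`. -/
def calF1 (ρ : Measure (Euc da × Euc dw × ℝ)) (ΨA : Euc da → Euc dx → ℝ)
    (ΨW : Euc dw → Euc dz → ℝ) (ζ1 σ1 : ℝ) (μx : Measure (Euc dx))
    (μz : Measure (Euc dz)) : EReal :=
  ((F1 ρ ΨA ΨW ζ1 μx μz : ℝ) : EReal) + (σ1 : EReal) * Ent μz

/-- `𝓕₂ = F₂ + σ₂·Ent(μ_x)`, valued in `ℝ ∪ {+∞}`. -/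
def calF2 (ρ : Measure (Euc da × Euc dw × ℝ)) (ΨW : Euc dw → Euc dz → ℝ) (ζ2 σ2 : ℝ)
    (μx : Measure (Euc dx)) (μz : Measure (Euc dz)) : EReal :=
  ((F2 ρ ΨW ζ2 μx μz : ℝ) : EReal) + (σ2 : EReal) * Ent μx

/-- Assumption (A1): bounded target, `|y| ≤ M` for `ρ`-a.e. `(𝐚, 𝐰, y)`. -/
def A1 (ρ : Measure (Euc da × Euc dw × ℝ)) (M : ℝ) : Prop :=
  ∀ᵐ p ∂ρ, |p.2.2| ≤ M

/-- Assumption (A2): jointly measurable, bounded and smooth networks with bounded gradients. -/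
def A2 (ΨA : Euc da → Euc dx → ℝ) (ΨW : Euc dw → Euc dz → ℝ) (R : ℝ) : Prop :=
  Measurable (Function.uncurry ΨA) ∧ Measurable (Function.uncurry ΨW) ∧
    (∀ a x, |ΨA a x| ≤ R) ∧ (∀ w z, |ΨW w z| ≤ R) ∧
    (∀ a, Differentiable ℝ (ΨA a)) ∧ (∀ a x, ‖fderiv ℝ (ΨA a) x‖ ≤ R) ∧
    (∀ w, Differentiable ℝ (ΨW w)) ∧ (∀ w z, ‖fderiv ℝ (ΨW w) z‖ ≤ R)

/-- A Stage-I selection: to each `μ_x ∈ P₂` it assigns a global minimizer of `𝓕₁(μ_x, ·)`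
over `P₂(ℝ^{d_z})`, with finite value. -/
def IsStageOneSel (ρ : Measure (Euc da × Euc dw × ℝ)) (ΨA : Euc da → Euc dx → ℝ)
    (ΨW : Euc dw → Euc dz → ℝ) (ζ1 σ1 : ℝ)
    (sel : Measure (Euc dx) → Measure (Euc dz)) : Prop :=
  ∀ μx, IsP2 μx →
    IsP2 (sel μx) ∧ calF1 ρ ΨA ΨW ζ1 σ1 μx (sel μx) ≠ ⊤ ∧
      calF1 ρ ΨA ΨW ζ1 σ1 μx (sel μx) ≠ ⊥ ∧
      ∀ ν, IsP2 ν → calF1 ρ ΨA ΨW ζ1 σ1 μx (sel μx) ≤ calF1 ρ ΨA ΨW ζ1 σ1 μx ν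

/-- The Lagrangian `𝓛_λ(μ_x, μ_z) = 𝓕₂(μ_x, μ_z) + λ(𝓕₁(μ_x, μ_z) − 𝓕₁(μ_x, μ_z^*(μ_x)))`. -/
def Lag (ρ : Measure (Euc da × Euc dw × ℝ)) (ΨA : Euc da → Euc dx → ℝ)
    (ΨW : Euc dw → Euc dz → ℝ) (ζ1 ζ2 σ1 σ2 : ℝ)
    (sel : Measure (Euc dx) → Measure (Euc dz)) (lam : ℝ)
    (μx : Measure (Euc dx)) (μz : Measure (Euc dz)) : EReal :=
  calF2 ρ ΨW ζ2 σ2 μx μz +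
    (lam : EReal) * (calF1 ρ ΨA ΨW ζ1 σ1 μx μz - calF1 ρ ΨA ΨW ζ1 σ1 μx (sel μx))

end Setting

/-- The Kullback-Leibler divergence is convex in its first argument. -/
lemma klDiv_convex_left {α : Type*} [MeasurableSpace α] (μ ν τ : Measure α)
    [IsFiniteMeasure μ] [IsFiniteMeasure ν] [IsFiniteMeasure τ] {a b : NNReal}
    (hab : a + b = 1) (hμ : μ ≪ τ) (hν : ν ≪ τ) :
    InformationTheory.klDiv (a • μ + b • ν) τ
      ≤ a * InformationTheory.klDiv μ τ + b * InformationTheory.klDiv ν τ := by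
  have hac : a • μ + b • ν ≪ τ :=
    Measure.AbsolutelyContinuous.add_left (hμ.smul_left a) (hν.smul_left b)
  rw [InformationTheory.klDiv_eq_lintegral_klFun_of_ac hμ,
    InformationTheory.klDiv_eq_lintegral_klFun_of_ac hν,
    InformationTheory.klDiv_eq_lintegral_klFun_of_ac hac,
    ← lintegral_const_mul _ (by fun_prop), ← lintegral_const_mul _ (by fun_prop),
    ← lintegral_add_left (by fun_prop)]
  refine lintegral_mono_ae ?_
  filter_upwards [Measure.rnDeriv_add (a • μ) (b • ν) τ, Measure.rnDeriv_smul_left μ τ a,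
    Measure.rnDeriv_smul_left ν τ b, Measure.rnDeriv_lt_top μ τ, Measure.rnDeriv_lt_top ν τ]
    with x h1 h2 h3 h4 h5
  have key : (Measure.rnDeriv (a • μ + b • ν) τ x).toReal
      = a * (μ.rnDeriv τ x).toReal + b * (ν.rnDeriv τ x).toReal := by
    rw [h1, Pi.add_apply, h2, h3, Pi.smul_apply, Pi.smul_apply, ENNReal.smul_def,
      ENNReal.smul_def, smul_eq_mul, smul_eq_mul, ENNReal.toReal_add, ENNReal.toReal_mul,
      ENNReal.toReal_mul]
    · simp
    · exact ENNReal.mul_ne_top (by simp) h4.ne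
    · exact ENNReal.mul_ne_top (by simp) h5.ne
  have hk := InformationTheory.convexOn_klFun.2 (x := (μ.rnDeriv τ x).toReal)
    (y := (ν.rnDeriv τ x).toReal) (by simp) (by simp) a.2 b.2 (congrArg NNReal.toReal hab)
  simp only [smul_eq_mul] at hk
  have n1 := InformationTheory.klFun_nonneg (x := (μ.rnDeriv τ x).toReal) (by simp)
  have n2 := InformationTheory.klFun_nonneg (x := (ν.rnDeriv τ x).toReal) (by simp)
  rw [key]
  calc _ ≤ _ := ENNReal.ofReal_le_ofReal hk
    _ = _ := by
      rw [ENNReal.ofReal_add (mul_nonneg a.2 n1) (mul_nonneg b.2 n2),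
        ENNReal.ofReal_mul a.2, ENNReal.ofReal_mul b.2]
      simp

/-- **Pinsker's inequality** tested against a bounded function. -/
lemma sq_integral_sub_integral_le {α : Type*} [MeasurableSpace α] (μ ν : Measure α)
    [IsProbabilityMeasure μ] [IsProbabilityMeasure ν] (hμν : μ ≪ ν)
    (hint : Integrable (llr μ ν) μ) {f : α → ℝ} (hf : Measurable f) {R : ℝ} (hR : 0 < R)
    (hfR : ∀ x, |f x| ≤ R) :
    ((∫ x, f x ∂μ) - ∫ x, f x ∂ν) ^ 2 ≤ 2 * R ^ 2 * ∫ x, llr μ ν x ∂μ := by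
  set m := ∫ x, f x ∂ν with hm
  set Δ := (∫ x, f x ∂μ) - m with hΔ
  set t := Δ / R ^ 2 with ht
  have hsub := hasSubgaussianMGF_of_mem_Icc (μ := ν) (X := f) (a := -R) (b := R)
    hf.aemeasurable (ae_of_all _ fun x => abs_le.1 (hfR x))
  have hfμ : Integrable f μ := Integrable.of_bound hf.aestronglyMeasurable R (ae_of_all _ hfR)
  have hXμ : Integrable (fun x => t * (f x - m)) μ :=
    (hfμ.sub (integrable_const m)).const_mul t
  have hexp := hsub.integrable_exp_mul t
  have hprob : IsProbabilityMeasure (ν.tilted fun x => t * (f x - m)) :=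
    isProbabilityMeasure_tilted hexp
  have hgibbs := InformationTheory.integral_llr_add_sub_measure_univ_nonneg
    (hμν.trans (absolutelyContinuous_tilted hexp))
    (integrable_llr_tilted_right hμν hXμ hint hexp)
  rw [integral_llr_tilted_right hμν hXμ hexp hint] at hgibbs
  have hI : ∫ x, t * (f x - m) ∂μ = t * Δ := by
    rw [integral_const_mul, integral_sub hfμ (integrable_const m)]
    simp [hΔ]
  have hmgf : log (∫ x, exp (t * (f x - m)) ∂ν) ≤ R ^ 2 * t ^ 2 / 2 := by
    have h := hsub.mgf_le t
    rw [mgf] at h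
    refine (Real.log_le_log (integral_exp_pos hexp) h).trans_eq ?_
    rw [Real.log_exp]
    have : ((‖R - -R‖₊ / 2) ^ 2 : NNReal) = (R ^ 2 : ℝ) := by
      push_cast
      rw [sub_neg_eq_add, ← two_mul, Real.norm_of_nonneg (by positivity)]
      ring
    rw [this]
  simp only [probReal_univ, add_sub_cancel_right] at hgibbs
  rw [hI] at hgibbs
  have hkey : Δ ^ 2 / (2 * R ^ 2) ≤ ∫ x, llr μ ν x ∂μ := by
    have : t * Δ - R ^ 2 * t ^ 2 / 2 = Δ ^ 2 / (2 * R ^ 2) := by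
      rw [ht]; field_simp; ring
    linarith
  rwa [div_le_iff₀' (by positivity)] at hkey

/-- Gaussians are integrable on Euclidean space. -/
lemma integrable_exp_neg_mul_norm_sq {d : ℕ} {c : ℝ} (hc : 0 < c) :
    Integrable (fun x : Euc d => exp (-(c * ‖x‖ ^ 2))) := by
  have h := (GaussianFourier.integrable_cexp_neg_mul_sq_norm_add (V := Euc d)
    (b := (c : ℂ)) (by simpa using hc) 0 0).norm
  refine h.congr (ae_of_all _ fun x => ?_)
  simp only [Complex.norm_exp]
  congr 1
  norm_cast
  simp

section GibbsPotential

variable {d : ℕ} {b : Euc d → ℝ} {C c : ℝ}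

lemma integrable_exp_gibbs (hb : Measurable b) (hbC : ∀ x, |b x| ≤ C) (hc : 0 < c) :
    Integrable (fun x => exp (-(c * ‖x‖ ^ 2 + b x))) := by
  refine ((integrable_exp_neg_mul_norm_sq (d := d) hc).const_mul (exp C)).mono'
    (by fun_prop) (ae_of_all _ fun x => ?_)
  rw [Real.norm_of_nonneg (exp_pos _).le, ← Real.exp_add]
  exact Real.exp_le_exp.2 (by linarith [neg_abs_le (b x), hbC x])

lemma isP2_tilted_gibbs (hb : Measurable b) (hbC : ∀ x, |b x| ≤ C) (hc : 0 < c) :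
    IsP2 ((volume : Measure (Euc d)).tilted fun x => -(c * ‖x‖ ^ 2 + b x)) := by
  have hexp := integrable_exp_gibbs hb hbC hc
  refine ⟨isProbabilityMeasure_tilted hexp, (integrable_tilted_iff hexp _).2 ?_⟩
  refine ((integrable_exp_neg_mul_norm_sq (d := d) (half_pos hc)).const_mul
    (exp C * (2 / c))).mono' (by fun_prop) (ae_of_all _ fun x => ?_)
  rw [smul_eq_mul, Real.norm_of_nonneg (by positivity)]
  have h1 : ‖x‖ ^ 2 ≤ 2 / c * exp (c / 2 * ‖x‖ ^ 2) := by
    have h := Real.add_one_le_exp (c / 2 * ‖x‖ ^ 2)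
    rw [div_mul_eq_mul_div, le_div_iff₀ hc]
    linarith
  have h2 : exp (-(c * ‖x‖ ^ 2 + b x)) ≤ exp C * exp (-(c * ‖x‖ ^ 2)) := by
    rw [← Real.exp_add]
    exact Real.exp_le_exp.2 (by linarith [neg_abs_le (b x), hbC x])
  calc exp (-(c * ‖x‖ ^ 2 + b x)) * ‖x‖ ^ 2
      ≤ exp C * exp (-(c * ‖x‖ ^ 2)) * (2 / c * exp (c / 2 * ‖x‖ ^ 2)) := by gcongr
    _ = exp C * (2 / c) * (exp (-(c * ‖x‖ ^ 2)) * exp (c / 2 * ‖x‖ ^ 2)) := by ring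
    _ = exp C * (2 / c) * exp (-(c / 2 * ‖x‖ ^ 2)) := by
      rw [← Real.exp_add]; congr 2; ring

lemma IsP2.integrable_gibbs {ν : Measure (Euc d)} (hν : IsP2 ν) (hb : Measurable b)
    (hbC : ∀ x, |b x| ≤ C) : Integrable (fun x => -(c * ‖x‖ ^ 2 + b x)) ν := by
  have := hν.1
  exact ((hν.2.const_mul c).add
    (Integrable.of_bound hb.aestronglyMeasurable C (ae_of_all _ hbC))).neg

end GibbsPotential

lemma measurable_integral_param {α β : Type*} [MeasurableSpace α] [MeasurableSpace β]
    {Ψ : α → β → ℝ} (hΨ : Measurable (Function.uncurry Ψ)) (ν : Measure β) [SFinite ν] :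
    Measurable fun w => ∫ z, Ψ w z ∂ν :=
  (hΨ.stronglyMeasurable.integral_prod_right (ν := ν)).measurable

lemma abs_integral_le_of_abs_le {β : Type*} [MeasurableSpace β] {f : β → ℝ} {R : ℝ}
    (hf : ∀ z, |f z| ≤ R) (ν : Measure β) [IsProbabilityMeasure ν] : |∫ z, f z ∂ν| ≤ R := by
  simpa using norm_integral_le_of_norm_le_const (μ := ν) (f := f) (C := R) (ae_of_all _ hf)

section BoundedFeature

variable {X : Type*} [MeasurableSpace X] {d : ℕ} {Φ : X → Euc d → ℝ} {g : X → ℝ} {R G : ℝ}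

lemma measurable_weighted_feature (hΦ : Measurable (Function.uncurry Φ)) (hg : Measurable g)
    (ρ : Measure X) [IsProbabilityMeasure ρ] : Measurable fun z => ∫ p, g p * Φ p z ∂ρ := by
  refine measurable_integral_param (Ψ := fun z p => g p * Φ p z) ?_ ρ
  exact (hg.comp measurable_snd).mul (hΦ.comp measurable_swap)

lemma abs_mul_le_of_abs_le {x y G R : ℝ} (hx : |x| ≤ G) (hy : |y| ≤ R) : |x * y| ≤ G * R := by
  rw [abs_mul]
  exact mul_le_mul hx hy (abs_nonneg _) ((abs_nonneg _).trans hx)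

lemma integral_weighted_feature (hΦ : Measurable (Function.uncurry Φ)) (hg : Measurable g)
    (hΦR : ∀ p z, |Φ p z| ≤ R) (hgG : ∀ p, |g p| ≤ G)
    (ρ : Measure X) [IsProbabilityMeasure ρ] (ν : Measure (Euc d)) [IsProbabilityMeasure ν] :
    ∫ z, ∫ p, g p * Φ p z ∂ρ ∂ν = ∫ p, g p * ∫ z, Φ p z ∂ν ∂ρ := by
  rw [integral_integral_swap]
  · simp_rw [integral_const_mul]
  · refine Integrable.of_bound (C := G * R) ?_ (ae_of_all _ fun q => ?_)
    · exact ((hg.comp measurable_snd).mul (hΦ.comp measurable_swap)).aestronglyMeasurable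
    · exact abs_mul_le_of_abs_le (hgG q.2) (hΦR q.2 q.1)

/-- The log-density, up to normalization, of the Gibbs measure with confinement `ζ` and
temperature `σ` driven by the features `Φ` with weights `g`. -/
def gibbsExponent (ρ : Measure X) (Φ : X → Euc d → ℝ) (g : X → ℝ) (ζ σ : ℝ) (z : Euc d) : ℝ :=
  -(ζ / (2 * σ) * ‖z‖ ^ 2 + σ⁻¹ * ∫ p, g p * Φ p z ∂ρ)

variable {ζ σ : ℝ}

lemma abs_scaled_weighted_feature_le (hΦR : ∀ p z, |Φ p z| ≤ R) (hgG : ∀ p, |g p| ≤ G)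
    (hσ : 0 < σ) (ρ : Measure X) [IsProbabilityMeasure ρ] (z : Euc d) :
    |σ⁻¹ * ∫ p, g p * Φ p z ∂ρ| ≤ σ⁻¹ * (G * R) :=
  abs_mul_le_of_abs_le (abs_of_pos (inv_pos.2 hσ)).le
    (abs_integral_le_of_abs_le (fun p => abs_mul_le_of_abs_le (hgG p) (hΦR p z)) ρ)

lemma integrable_exp_gibbsExponent (hΦ : Measurable (Function.uncurry Φ)) (hg : Measurable g)
    (hΦR : ∀ p z, |Φ p z| ≤ R) (hgG : ∀ p, |g p| ≤ G) (hζ : 0 < ζ) (hσ : 0 < σ)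
    (ρ : Measure X) [IsProbabilityMeasure ρ] :
    Integrable (fun z => exp (gibbsExponent ρ Φ g ζ σ z)) :=
  integrable_exp_gibbs ((measurable_weighted_feature hΦ hg ρ).const_mul _)
    (abs_scaled_weighted_feature_le hΦR hgG hσ ρ) (by positivity)

lemma isP2_tilted_gibbsExponent (hΦ : Measurable (Function.uncurry Φ)) (hg : Measurable g)
    (hΦR : ∀ p z, |Φ p z| ≤ R) (hgG : ∀ p, |g p| ≤ G) (hζ : 0 < ζ) (hσ : 0 < σ)
    (ρ : Measure X) [IsProbabilityMeasure ρ] :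
    IsP2 ((volume : Measure (Euc d)).tilted (gibbsExponent ρ Φ g ζ σ)) :=
  isP2_tilted_gibbs ((measurable_weighted_feature hΦ hg ρ).const_mul _)
    (abs_scaled_weighted_feature_le hΦR hgG hσ ρ) (by positivity)

lemma integrable_gibbsExponent (hΦ : Measurable (Function.uncurry Φ)) (hg : Measurable g)
    (hΦR : ∀ p z, |Φ p z| ≤ R) (hgG : ∀ p, |g p| ≤ G) (hσ : 0 < σ)
    (ρ : Measure X) [IsProbabilityMeasure ρ] {ν : Measure (Euc d)} (hν : IsP2 ν) :
    Integrable (gibbsExponent ρ Φ g ζ σ) ν :=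
  hν.integrable_gibbs ((measurable_weighted_feature hΦ hg ρ).const_mul _)
    (abs_scaled_weighted_feature_le hΦR hgG hσ ρ)

lemma integral_gibbsExponent (hΦ : Measurable (Function.uncurry Φ)) (hg : Measurable g)
    (hΦR : ∀ p z, |Φ p z| ≤ R) (hgG : ∀ p, |g p| ≤ G) (hσ : 0 < σ)
    (ρ : Measure X) [IsProbabilityMeasure ρ] {ν : Measure (Euc d)} (hν : IsP2 ν) :
    ∫ z, gibbsExponent ρ Φ g ζ σ z ∂ν
      = -(ζ / (2 * σ) * ∫ z, ‖z‖ ^ 2 ∂ν + σ⁻¹ * ∫ p, g p * ∫ z, Φ p z ∂ν ∂ρ) := by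
  have := hν.1
  unfold gibbsExponent
  rw [integral_neg, integral_add (hν.2.const_mul _), integral_const_mul, integral_const_mul,
    integral_weighted_feature hΦ hg hΦR hgG]
  exact Integrable.of_bound
    ((measurable_weighted_feature hΦ hg ρ).const_mul _).aestronglyMeasurable _
    (ae_of_all _ (abs_scaled_weighted_feature_le hΦR hgG hσ ρ))

end BoundedFeature

/-- Integrability of the log-likelihood ratio passes from a tilted reference measure back to the
original one. -/
lemma integrable_llr_of_tilted_right {α : Type*} [MeasurableSpace α] {μ ν : Measure α}
    [IsFiniteMeasure μ] [SigmaFinite ν] {f : α → ℝ} (hμν : μ ≪ ν) (hfμ : Integrable f μ)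
    (hfν : Integrable (fun x => exp (f x)) ν) (h : Integrable (llr μ (ν.tilted f)) μ) :
    Integrable (llr μ ν) μ := by
  refine ((h.add hfμ).sub (integrable_const (log (∫ z, exp (f z) ∂ν)))).congr ?_
  filter_upwards [llr_tilted_right hμν hfν] with x hx
  simp only [Pi.add_apply, Pi.sub_apply, hx]
  ring

lemma IsP2.mix {d : ℕ} {μ ν : Measure (Euc d)} (hμ : IsP2 μ) (hν : IsP2 ν) {a b : NNReal}
    (hab : a + b = 1) : IsP2 (a • μ + b • ν) := by
  have := hμ.1
  have := hν.1
  refine ⟨⟨?_⟩, (hμ.2.smul_measure_nnreal).add_measure hν.2.smul_measure_nnreal⟩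
  simp only [Measure.coe_add, Measure.coe_nnreal_smul_apply, Pi.add_apply, measure_univ, mul_one]
  exact_mod_cast hab

lemma integral_mix {α : Type*} [MeasurableSpace α] {μ ν : Measure α} {f : α → ℝ}
    (hμ : Integrable f μ) (hν : Integrable f ν) (a b : NNReal) :
    ∫ x, f x ∂(a • μ + b • ν) = a * ∫ x, f x ∂μ + b * ∫ x, f x ∂ν := by
  rw [integral_add_measure hμ.smul_measure_nnreal hν.smul_measure_nnreal,
    integral_smul_nnreal_measure, integral_smul_nnreal_measure]
  rfl

section StageOne

variable {da dw dx dz : ℕ} {ρ : Measure (Euc da × Euc dw × ℝ)} {ΨA : Euc da → Euc dx → ℝ}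
  {ΨW : Euc dw → Euc dz → ℝ} {R ζ σ : ℝ} {μx : Measure (Euc dx)} {ν : Measure (Euc dz)}

lemma calF1_eq_coe (hac : ν ≪ volume) (hint : Integrable (llr ν volume) ν) :
    calF1 ρ ΨA ΨW ζ σ μx ν
      = ((F1 ρ ΨA ΨW ζ μx ν + σ * ∫ x, llr ν volume x ∂ν : ℝ) : EReal) := by
  have hE : Ent ν = ((∫ x, llr ν volume x ∂ν : ℝ) : EReal) := if_pos ⟨hac, hint⟩
  rw [calF1, hE]
  norm_cast

lemma ac_and_integrable_of_calF1_ne_top (hσ : 0 < σ) (h : calF1 ρ ΨA ΨW ζ σ μx ν ≠ ⊤) :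
    ν ≪ volume ∧ Integrable (llr ν volume) ν := by
  by_contra hc
  apply h
  have hE : Ent ν = ⊤ := if_neg hc
  rw [calF1, hE, EReal.coe_mul_top_of_pos hσ, EReal.coe_add_top]

/-- The prediction residual `(𝐚, 𝐰, y) ↦ ∫ Ψ_𝐰 dμ_z - ∫ Ψ_𝐚 dμ_x`. -/
def stageOneResidual (ΨA : Euc da → Euc dx → ℝ) (ΨW : Euc dw → Euc dz → ℝ) (μx : Measure (Euc dx))
    (μz : Measure (Euc dz)) (p : Euc da × Euc dw × ℝ) : ℝ :=
  (∫ z, ΨW p.2.1 z ∂μz) - ∫ x, ΨA p.1 x ∂μx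

/-- The exponent of the Gibbs measure characterizing the minimizer of `𝓕₁(μ_x, ·)`. -/
def stageOneExponent (ρ : Measure (Euc da × Euc dw × ℝ)) (ΨA : Euc da → Euc dx → ℝ)
    (ΨW : Euc dw → Euc dz → ℝ) (ζ σ : ℝ) (μx : Measure (Euc dx)) (μz : Measure (Euc dz)) :
    Euc dz → ℝ :=
  gibbsExponent ρ (fun p => ΨW p.2.1) (stageOneResidual ΨA ΨW μx μz) ζ σ

lemma A2.measurable_feature (h : A2 ΨA ΨW R) :
    Measurable (Function.uncurry fun (p : Euc da × Euc dw × ℝ) => ΨW p.2.1) :=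
  h.2.1.comp ((measurable_fst.comp (measurable_snd.comp measurable_fst)).prodMk measurable_snd)

lemma A2.measurable_meanW (h : A2 ΨA ΨW R) (ν : Measure (Euc dz)) [SFinite ν] :
    Measurable fun p : Euc da × Euc dw × ℝ => ∫ z, ΨW p.2.1 z ∂ν :=
  measurable_integral_param h.measurable_feature ν

lemma A2.measurable_meanA (h : A2 ΨA ΨW R) (μx : Measure (Euc dx)) [SFinite μx] :
    Measurable fun p : Euc da × Euc dw × ℝ => ∫ x, ΨA p.1 x ∂μx :=
  (measurable_integral_param h.1 μx).comp measurable_fst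

lemma A2.measurable_stageOneResidual (h : A2 ΨA ΨW R) (μx : Measure (Euc dx)) (ν : Measure (Euc dz))
    [SFinite μx] [SFinite ν] : Measurable (stageOneResidual (da := da) (dw := dw) ΨA ΨW μx ν) :=
  (h.measurable_meanW ν).sub (h.measurable_meanA μx)

lemma A2.abs_stageOneResidual_le (h : A2 ΨA ΨW R) (μx : Measure (Euc dx)) (ν : Measure (Euc dz))
    [IsProbabilityMeasure μx] [IsProbabilityMeasure ν] (p : Euc da × Euc dw × ℝ) :
    |stageOneResidual ΨA ΨW μx ν p| ≤ 2 * R := by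
  have h1 := abs_integral_le_of_abs_le (h.2.2.2.1 p.2.1) ν
  have h2 := abs_integral_le_of_abs_le (h.2.2.1 p.1) μx
  rw [stageOneResidual]
  exact (abs_sub _ _).trans (by linarith)

lemma A2.integrable_meanW_mul_meanW (h : A2 ΨA ΨW R) [IsProbabilityMeasure ρ]
    (μ ν : Measure (Euc dz)) [IsProbabilityMeasure μ] [IsProbabilityMeasure ν] :
    Integrable (fun p => (∫ z, ΨW p.2.1 z ∂μ) * ∫ z, ΨW p.2.1 z ∂ν) ρ :=
  Integrable.of_bound ((h.measurable_meanW μ).mul (h.measurable_meanW ν)).aestronglyMeasurable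
    (R * R) (ae_of_all _ fun p => abs_mul_le_of_abs_le
      (abs_integral_le_of_abs_le (h.2.2.2.1 p.2.1) μ)
      (abs_integral_le_of_abs_le (h.2.2.2.1 p.2.1) ν))

lemma A2.integrable_stageOneResidual_mul_meanW (h : A2 ΨA ΨW R) [IsProbabilityMeasure ρ]
    (μx : Measure (Euc dx)) (μ ν : Measure (Euc dz)) [IsProbabilityMeasure μx]
    [IsProbabilityMeasure μ] [IsProbabilityMeasure ν] :
    Integrable (fun p => stageOneResidual ΨA ΨW μx μ p * ∫ z, ΨW p.2.1 z ∂ν) ρ :=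
  Integrable.of_bound
    ((h.measurable_stageOneResidual μx μ).mul (h.measurable_meanW ν)).aestronglyMeasurable
    (2 * R * R) (ae_of_all _ fun p => abs_mul_le_of_abs_le (h.abs_stageOneResidual_le μx μ p)
      (abs_integral_le_of_abs_le (h.2.2.2.1 p.2.1) ν))


lemma F1_add_integral_llr_eq (h : A2 ΨA ΨW R) (hζ : 0 < ζ) (hσ : 0 < σ)
    [IsProbabilityMeasure ρ] [IsProbabilityMeasure μx] {μ : Measure (Euc dz)}
    [IsProbabilityMeasure μ] (hν : IsP2 ν)
    (hac : ν ≪ volume) (hint : Integrable (llr ν volume) ν) :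
    F1 ρ ΨA ΨW ζ μx ν + σ * ∫ x, llr ν volume x ∂ν
      = (1 / 2) * (∫ p, ((∫ z, ΨW p.2.1 z ∂ν) - ∫ z, ΨW p.2.1 z ∂μ) ^ 2 ∂ρ)
        + σ * (∫ x, llr ν (volume.tilted (stageOneExponent ρ ΨA ΨW ζ σ μx μ)) x ∂ν)
        + ((1 / 2) * (∫ p, (∫ x, ΨA p.1 x ∂μx) ^ 2 ∂ρ)
          - (1 / 2) * (∫ p, (∫ z, ΨW p.2.1 z ∂μ) ^ 2 ∂ρ)
          - σ * log (∫ z, exp (stageOneExponent ρ ΨA ΨW ζ σ μx μ z))) := by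
  have := hν.1
  have hΦR : ∀ (p : Euc da × Euc dw × ℝ) z, |ΨW p.2.1 z| ≤ R := fun p z => h.2.2.2.1 p.2.1 z
  have hmr := h.measurable_stageOneResidual (da := da) (dw := dw) μx μ
  have hbr := h.abs_stageOneResidual_le (da := da) (dw := dw) μx μ
  have hexp := integrable_exp_gibbsExponent h.measurable_feature hmr hΦR hbr hζ hσ ρ
  have hf := integrable_gibbsExponent (ζ := ζ) h.measurable_feature hmr hΦR hbr hσ ρ hν
  have hI := integral_gibbsExponent (ζ := ζ) h.measurable_feature hmr hΦR hbr hσ ρ hν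
  unfold stageOneExponent
  rw [integral_llr_tilted_right hac hf hexp hint, hI, F1, U1]
  have hA2 : Integrable (fun p => (∫ x, ΨA p.1 x ∂μx) ^ 2) ρ := by
    refine Integrable.of_bound ((h.measurable_meanA μx).pow_const 2).aestronglyMeasurable
      (R * R) (ae_of_all _ fun p => ?_)
    have := abs_integral_le_of_abs_le (h.2.2.1 p.1) μx
    rw [sq]
    exact abs_mul_le_of_abs_le this this
  have hM2 : Integrable (fun p => (∫ z, ΨW p.2.1 z ∂μ) ^ 2) ρ := by
    simpa only [sq] using h.integrable_meanW_mul_meanW (ρ := ρ) μ μ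
  have hD : Integrable (fun p => ((∫ z, ΨW p.2.1 z ∂ν) - ∫ z, ΨW p.2.1 z ∂μ) ^ 2) ρ := by
    have := (((h.integrable_meanW_mul_meanW (ρ := ρ) ν ν).add
      (h.integrable_meanW_mul_meanW (ρ := ρ) μ μ)).sub
      ((h.integrable_meanW_mul_meanW (ρ := ρ) ν μ).const_mul 2))
    refine this.congr (ae_of_all _ fun p => ?_)
    simp only [Pi.add_apply, Pi.sub_apply]
    ring
  have hG := h.integrable_stageOneResidual_mul_meanW (ρ := ρ) μx μ ν
  have key : ∫ p, ((∫ z, ΨW p.2.1 z ∂ν) - ∫ x, ΨA p.1 x ∂μx) ^ 2 ∂ρ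
      = (∫ p, ((∫ z, ΨW p.2.1 z ∂ν) - ∫ z, ΨW p.2.1 z ∂μ) ^ 2 ∂ρ)
        + 2 * (∫ p, stageOneResidual ΨA ΨW μx μ p * ∫ z, ΨW p.2.1 z ∂ν ∂ρ)
        + (∫ p, (∫ x, ΨA p.1 x ∂μx) ^ 2 ∂ρ) - ∫ p, (∫ z, ΨW p.2.1 z ∂μ) ^ 2 ∂ρ := by
    rw [← integral_const_mul, ← integral_add' hD (hG.const_mul 2),
      ← integral_add' (hD.add (hG.const_mul 2)) hA2,
      ← integral_sub' ((hD.add (hG.const_mul 2)).add hA2) hM2]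
    refine integral_congr_ae (ae_of_all _ fun p => ?_)
    simp only [stageOneResidual, Pi.add_apply, Pi.sub_apply]
    ring
  rw [key]
  field_simp
  ring

/-- A minimizer of `𝓕₁(μ_x, ·)` is the Gibbs measure of its own linearized potential. -/
lemma eq_tilted_of_isMin_calF1 (h : A2 ΨA ΨW R) (hζ : 0 < ζ) (hσ : 0 < σ)
    [IsProbabilityMeasure ρ] (hμx : IsP2 μx) {μ : Measure (Euc dz)} (hμ : IsP2 μ)
    (hfin : calF1 ρ ΨA ΨW ζ σ μx μ ≠ ⊤)
    (hmin : ∀ ν, IsP2 ν → calF1 ρ ΨA ΨW ζ σ μx μ ≤ calF1 ρ ΨA ΨW ζ σ μx ν) :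
    μ = volume.tilted (stageOneExponent ρ ΨA ΨW ζ σ μx μ) := by
  have := hμx.1
  have := hμ.1
  obtain ⟨hac, hint⟩ := ac_and_integrable_of_calF1_ne_top hσ hfin
  have hΦR : ∀ (p : Euc da × Euc dw × ℝ) z, |ΨW p.2.1 z| ≤ R := fun p z => h.2.2.2.1 p.2.1 z
  have hmr := h.measurable_stageOneResidual (da := da) (dw := dw) μx μ
  have hbr := h.abs_stageOneResidual_le (da := da) (dw := dw) μx μ
  have hexp : Integrable (fun z => exp (stageOneExponent ρ ΨA ΨW ζ σ μx μ z)) :=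
    integrable_exp_gibbsExponent h.measurable_feature hmr hΦR hbr hζ hσ ρ
  have hf : ∀ {ν}, IsP2 ν → Integrable (stageOneExponent ρ ΨA ΨW ζ σ μx μ) ν := fun hν =>
    integrable_gibbsExponent (ζ := ζ) h.measurable_feature hmr hΦR hbr hσ ρ hν
  set τ := (volume : Measure (Euc dz)).tilted (stageOneExponent ρ ΨA ΨW ζ σ μx μ) with hτdef
  have hτ : IsP2 τ := isP2_tilted_gibbsExponent h.measurable_feature hmr hΦR hbr hζ hσ ρ
  have := hτ.1
  have hvτ : (volume : Measure (Euc dz)) ≪ τ := absolutelyContinuous_tilted hexp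
  have hτv : τ ≪ volume := tilted_absolutelyContinuous _ _
  have hacτ : μ ≪ τ := hac.trans hvτ
  have hintτ : Integrable (llr μ τ) μ := integrable_llr_tilted_right hac (hf hμ) hint hexp
  have hKreal : (InformationTheory.klDiv μ τ).toReal = ∫ x, llr μ τ x ∂μ :=
    InformationTheory.toReal_klDiv_of_measure_eq hacτ (by simp)
  have hKtop := InformationTheory.klDiv_ne_top hacτ hintτ
  set K := (InformationTheory.klDiv μ τ).toReal with hK
  set D := ∫ p, ((∫ z, ΨW p.2.1 z ∂τ) - ∫ z, ΨW p.2.1 z ∂μ) ^ 2 ∂ρ with hD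
  have hD0 : 0 ≤ D := integral_nonneg fun p => sq_nonneg _
  have hK0 : 0 ≤ K := ENNReal.toReal_nonneg
  have descent : ∀ t : ℝ, 0 < t → t ≤ 1 → σ * K ≤ t * D / 2 := by
    intro t ht0 ht1
    obtain ⟨a, ha⟩ : ∃ a : NNReal, (a : ℝ) = 1 - t := ⟨⟨1 - t, by linarith⟩, rfl⟩
    obtain ⟨b, hb⟩ : ∃ b : NNReal, (b : ℝ) = t := ⟨⟨t, ht0.le⟩, rfl⟩
    have hab : a + b = 1 := by
      apply NNReal.coe_injective
      push_cast
      linarith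
    have hκ : IsP2 (a • μ + b • τ) := hμ.mix hτ hab
    have := hκ.1
    have hconv := klDiv_convex_left μ τ τ hab hacτ Measure.AbsolutelyContinuous.rfl
    rw [InformationTheory.klDiv_self, mul_zero, add_zero] at hconv
    have htop : (a : ℝ≥0∞) * InformationTheory.klDiv μ τ ≠ ⊤ :=
      ENNReal.mul_ne_top (by simp) hKtop
    obtain ⟨hκτ, hκint⟩ := InformationTheory.klDiv_ne_top_iff.1
      (ne_top_of_le_ne_top htop hconv)
    have hκK : ∫ x, llr (a • μ + b • τ) τ x ∂(a • μ + b • τ) ≤ (1 - t) * K := by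
      rw [← InformationTheory.toReal_klDiv_of_measure_eq hκτ (by simp only [measure_univ])]
      refine (ENNReal.toReal_mono htop hconv).trans_eq ?_
      rw [ENNReal.toReal_mul, ENNReal.coe_toReal, ha]
    have hκv := hκτ.trans hτv
    have hκintv := integrable_llr_of_tilted_right hκv (hf hκ) hexp hκint
    have hle := hmin _ hκ
    rw [calF1_eq_coe hac hint, calF1_eq_coe hκv hκintv, EReal.coe_le_coe_iff,
      F1_add_integral_llr_eq (μ := μ) h hζ hσ hμ hac hint,
      F1_add_integral_llr_eq (μ := μ) h hζ hσ hκ hκv hκintv, ← hτdef, ← hKreal] at hle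
    have hsq : ∫ p, ((∫ z, ΨW p.2.1 z ∂(a • μ + b • τ)) - ∫ z, ΨW p.2.1 z ∂μ) ^ 2 ∂ρ
        = t ^ 2 * D := by
      rw [hD, ← integral_const_mul]
      refine integral_congr_ae (ae_of_all _ fun p => ?_)
      have hi : ∀ (ν : Measure (Euc dz)) [IsProbabilityMeasure ν],
          Integrable (fun z => ΨW p.2.1 z) ν := fun ν _ =>
        Integrable.of_bound (h.2.2.2.2.2.2.1 p.2.1).continuous.aestronglyMeasurable R
          (ae_of_all _ (hΦR p))
      simp only
      rw [integral_mix (hi μ) (hi τ), ha, hb]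
      ring
    rw [hsq] at hle
    have hself : ∫ p : Euc da × Euc dw × ℝ,
        ((∫ z, ΨW p.2.1 z ∂μ) - ∫ z, ΨW p.2.1 z ∂μ) ^ 2 ∂ρ = 0 := by simp
    rw [hself] at hle
    have h1 : σ * ∫ x, llr (a • μ + b • τ) τ x ∂(a • μ + b • τ) ≤ σ * ((1 - t) * K) := by gcongr
    have h2 : t * (σ * K) ≤ t * (t * D / 2) := by linarith
    exact le_of_mul_le_mul_left h2 ht0
  have hKzero : K = 0 := by
    by_contra hne
    have hKpos : 0 < σ * K := mul_pos hσ (lt_of_le_of_ne hK0 (Ne.symm hne))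
    have h1 := descent (min 1 (σ * K / (D + 1))) (by positivity) (min_le_left _ _)
    have h2 : min 1 (σ * K / (D + 1)) * D ≤ σ * K := by
      calc min 1 (σ * K / (D + 1)) * D ≤ σ * K / (D + 1) * (D + 1) := by
            gcongr
            · exact min_le_right _ _
            · linarith
        _ = σ * K := by field_simp
    linarith
  rw [hK, ENNReal.toReal_eq_zero_iff] at hKzero
  exact InformationTheory.klDiv_eq_zero_iff.1 (hKzero.resolve_right hKtop)

end StageOne

/-- The Kullback-Leibler divergence between two tilted measures of a common reference measure. -/
lemma KL_eq_of_eq_tilted {α : Type*} [MeasurableSpace α] {μ ν₀ : Measure α}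
    [IsProbabilityMeasure μ] [SigmaFinite ν₀] {f f' : α → ℝ}
    (hf : Integrable (fun x => exp (f x)) ν₀) (hf' : Integrable (fun x => exp (f' x)) ν₀)
    (hfμ : Integrable f μ) (hf'μ : Integrable f' μ) (hμ : μ = ν₀.tilted f) :
    KL μ (ν₀.tilted f')
      = (((∫ x, f x ∂μ) - (∫ x, f' x ∂μ) - log (∫ x, exp (f x) ∂ν₀)
          + log (∫ x, exp (f' x) ∂ν₀) : ℝ) : EReal) := by
  have hac : μ ≪ ν₀ := hμ ▸ tilted_absolutelyContinuous _ _
  have hself : Integrable (llr μ (ν₀.tilted f)) μ := by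
    rw [← hμ, integrable_congr (llr_self μ)]
    exact integrable_zero _ _ _
  have hint := integrable_llr_of_tilted_right hac hfμ hf hself
  have h0 := integral_llr_tilted_right hac hfμ hf hint
  rw [← hμ, integral_congr_ae (llr_self μ)] at h0
  have h1 := integral_llr_tilted_right hac hf'μ hf' hint
  have hKL : KL μ (ν₀.tilted f') = ((∫ x, llr μ (ν₀.tilted f') x ∂μ : ℝ) : EReal) :=
    if_pos ⟨hac.trans (absolutelyContinuous_tilted hf'),
      integrable_llr_tilted_right hac hf'μ hint hf'⟩
  rw [hKL, h1]
  congr 1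
  simp only [Pi.zero_apply, integral_zero] at h0
  linarith

/-- Proposition 4.2: continuity of the Stage-I solution map,
`KL(μ, μ') + KL(μ', μ) ≤ (R²/(2σ₁))·KL(μ_x, μ_x')`. -/
theorem stmt6
    {da dw dx dz : ℕ} (hda : 0 < da) (hdw : 0 < dw) (hdx : 0 < dx) (hdz : 0 < dz)
    (R ζ1 σ1 : ℝ) (hR : 0 < R) (hζ1 : 0 < ζ1) (hσ1 : 0 < σ1)
    (ρ : Measure (Euc da × Euc dw × ℝ)) (hρ : IsProbabilityMeasure ρ)
    (ΨA : Euc da → Euc dx → ℝ) (ΨW : Euc dw → Euc dz → ℝ)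
    (hA2 : A2 ΨA ΨW R)
    (μx μx' : Measure (Euc dx)) (hμx : IsP2 μx) (hμx' : IsP2 μx')
    (μ μ' : Measure (Euc dz)) (hμ : IsP2 μ) (hμ' : IsP2 μ')
    (hμfin : calF1 ρ ΨA ΨW ζ1 σ1 μx μ ≠ ⊤ ∧ calF1 ρ ΨA ΨW ζ1 σ1 μx μ ≠ ⊥)
    (hμmin : ∀ ν, IsP2 ν → calF1 ρ ΨA ΨW ζ1 σ1 μx μ ≤ calF1 ρ ΨA ΨW ζ1 σ1 μx ν)
    (hμ'fin : calF1 ρ ΨA ΨW ζ1 σ1 μx' μ' ≠ ⊤ ∧ calF1 ρ ΨA ΨW ζ1 σ1 μx' μ' ≠ ⊥)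
    (hμ'min : ∀ ν, IsP2 ν → calF1 ρ ΨA ΨW ζ1 σ1 μx' μ' ≤ calF1 ρ ΨA ΨW ζ1 σ1 μx' ν) :
    KL μ μ' + KL μ' μ ≤ ((R ^ 2 / (2 * σ1) : ℝ) : EReal) * KL μx μx' := by
  have := hμx.1
  have := hμx'.1
  have := hμ.1
  have := hμ'.1
  by_cases hc : μx ≪ μx' ∧ Integrable (llr μx μx') μx
  swap
  · have hKL : KL μx μx' = ⊤ := if_neg hc
    rw [hKL, EReal.coe_mul_top_of_pos (by positivity)]
    exact le_top
  obtain ⟨hxac, hxint⟩ := hc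
  have hKLx : KL μx μx' = ((∫ x, llr μx μx' x ∂μx : ℝ) : EReal) := if_pos ⟨hxac, hxint⟩
  have hμt := eq_tilted_of_isMin_calF1 hA2 hζ1 hσ1 hμx hμ hμfin.1 hμmin
  have hμt' := eq_tilted_of_isMin_calF1 hA2 hζ1 hσ1 hμx' hμ' hμ'fin.1 hμ'min
  have hΦ : Measurable (Function.uncurry fun (p : Euc da × Euc dw × ℝ) => ΨW p.2.1) :=
    hA2.measurable_feature
  have hΦR : ∀ (p : Euc da × Euc dw × ℝ) z, |ΨW p.2.1 z| ≤ R := fun p z => hA2.2.2.2.1 p.2.1 z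
  have hm := hA2.measurable_stageOneResidual (da := da) (dw := dw) μx μ
  have hb := hA2.abs_stageOneResidual_le (da := da) (dw := dw) μx μ
  have hm' := hA2.measurable_stageOneResidual (da := da) (dw := dw) μx' μ'
  have hb' := hA2.abs_stageOneResidual_le (da := da) (dw := dw) μx' μ'
  have e := integrable_exp_gibbsExponent hΦ hm hΦR hb hζ1 hσ1 ρ
  have e' := integrable_exp_gibbsExponent hΦ hm' hΦR hb' hζ1 hσ1 ρ
  have k1 := KL_eq_of_eq_tilted e e' (integrable_gibbsExponent hΦ hm hΦR hb hσ1 ρ hμ)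
    (integrable_gibbsExponent hΦ hm' hΦR hb' hσ1 ρ hμ) hμt
  have k2 := KL_eq_of_eq_tilted e' e (integrable_gibbsExponent hΦ hm' hΦR hb' hσ1 ρ hμ')
    (integrable_gibbsExponent hΦ hm hΦR hb hσ1 ρ hμ') hμt'
  have r1 : volume.tilted (gibbsExponent ρ (fun p => ΨW p.2.1)
      (stageOneResidual ΨA ΨW μx μ) ζ1 σ1) = μ := hμt.symm
  have r2 : volume.tilted (gibbsExponent ρ (fun p => ΨW p.2.1)
      (stageOneResidual ΨA ΨW μx' μ') ζ1 σ1) = μ' := hμt'.symm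
  rw [r2] at k1
  rw [r1] at k2
  rw [k1, k2, hKLx, ← EReal.coe_add, ← EReal.coe_mul, EReal.coe_le_coe_iff,
    integral_gibbsExponent hΦ hm hΦR hb hσ1 ρ hμ,
    integral_gibbsExponent hΦ hm hΦR hb hσ1 ρ hμ',
    integral_gibbsExponent hΦ hm' hΦR hb' hσ1 ρ hμ,
    integral_gibbsExponent hΦ hm' hΦR hb' hσ1 ρ hμ']
  have i1 := hA2.integrable_stageOneResidual_mul_meanW (ρ := ρ) μx μ μ
  have i2 := hA2.integrable_stageOneResidual_mul_meanW (ρ := ρ) μx μ μ'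
  have i3 := hA2.integrable_stageOneResidual_mul_meanW (ρ := ρ) μx' μ' μ
  have i4 := hA2.integrable_stageOneResidual_mul_meanW (ρ := ρ) μx' μ' μ'
  have hbound : ∫ p, (stageOneResidual ΨA ΨW μx μ p * (∫ z, ΨW p.2.1 z ∂μ')
        - stageOneResidual ΨA ΨW μx μ p * (∫ z, ΨW p.2.1 z ∂μ)
        + (stageOneResidual ΨA ΨW μx' μ' p * (∫ z, ΨW p.2.1 z ∂μ)
        - stageOneResidual ΨA ΨW μx' μ' p * (∫ z, ΨW p.2.1 z ∂μ'))) ∂ρ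
      ≤ R ^ 2 / 2 * ∫ x, llr μx μx' x ∂μx := by
    refine (integral_mono ((i2.sub i1).add (i3.sub i4))
      (integrable_const (R ^ 2 / 2 * ∫ x, llr μx μx' x ∂μx)) fun p => ?_).trans_eq (by simp)
    have hp := sq_integral_sub_integral_le μx μx' hxac hxint
      (hA2.2.2.2.2.1 p.1).continuous.measurable hR (hA2.2.2.1 p.1)
    simp only [stageOneResidual, Pi.add_apply, Pi.sub_apply]
    nlinarith [sq_nonneg ((∫ z, ΨW p.2.1 z ∂μ) - (∫ z, ΨW p.2.1 z ∂μ')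
      - ((∫ x, ΨA p.1 x ∂μx) - ∫ x, ΨA p.1 x ∂μx') / 2)]
  have hsplit := integral_add' (i2.sub i1) (i3.sub i4)
  rw [integral_sub' i2 i1, integral_sub' i3 i4] at hsplit
  simp only [Pi.add_apply, Pi.sub_apply] at hsplit
  rw [hsplit] at hbound
  have hfinal := mul_le_mul_of_nonneg_left hbound (inv_pos.2 hσ1).le
  have hrhs : σ1⁻¹ * (R ^ 2 / 2 * ∫ x, llr μx μx' x ∂μx)
      = R ^ 2 / (2 * σ1) * ∫ x, llr μx μx' x ∂μx := by
    field_simp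
  rw [hrhs] at hfinal
  linarith
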